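/- Let p₁, p₂, p₃ ∈ ℂ. Then the function r(u,v,x,y) = (p₁uv + p₂(u+v) + p₃)/(u - v) - (p₁xy + p₂(x+y) + p₃)/(x - y) satisfies the scalar associative Yang–Baxter equation r(w,u,z,x) r(v,w,y,x) + r(u,v,x,y) r(w,u,z,y) + r(v,w,y,z) r(u,v,x,z) = 0 and the skew-symmetry r(u,v,x,y) = -r(v,u,y,x), at points where u,v,w are pairwise distinct and x,y,z are pairwise distinct. -/

import Mathlib

theorem cyclic_sum_mul_symm_div_sub {K : Type*} [Field K] (p₁ p₂ p₃ : K) {u v w : K}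
    (huv : u ≠ v) (huw : u ≠ w) (hvw : v ≠ w) :
    (p₁ * u * v + p₂ * (u + v) + p₃) / (u - v) * ((p₁ * v * w + p₂ * (v + w) + p₃) / (v - w)) +
      (p₁ * v * w + p₂ * (v + w) + p₃) / (v - w) * ((p₁ * w * u + p₂ * (w + u) + p₃) / (w - u)) +
      (p₁ * w * u + p₂ * (w + u) + p₃) / (w - u) * ((p₁ * u * v + p₂ * (u + v) + p₃) / (u - v)) =
    p₁ * p₃ - p₂ ^ 2 := by
  have h₁ := sub_ne_zero.mpr huv
  have h₂ := sub_ne_zero.mpr hvw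
  have h₃ := sub_ne_zero.mpr huw.symm
  field_simp
  ring

theorem symm_div_sub_swap {K : Type*} [Field K] (p₁ p₂ p₃ u v : K) :
    (p₁ * u * v + p₂ * (u + v) + p₃) / (u - v) =
      -((p₁ * v * u + p₂ * (v + u) + p₃) / (v - u)) := by
  rw [← neg_sub v u, div_neg]
  ring

theorem stmt_17 (p₁ p₂ p₃ : ℂ) :
    let r : ℂ → ℂ → ℂ → ℂ → ℂ := fun u v x y =>
      (p₁ * u * v + p₂ * (u + v) + p₃) / (u - v) -
      (p₁ * x * y + p₂ * (x + y) + p₃) / (x - y)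
    ∀ u v w x y z : ℂ, u ≠ v → u ≠ w → v ≠ w → x ≠ y → x ≠ z → y ≠ z →
      (r w u z x * r v w y x + r u v x y * r w u z y + r v w y z * r u v x z = 0) ∧
      r u v x y = -r v u y x := by
  intro r u v w x y z huv huw hvw hxy hxz hyz
  simp only [r]
  constructor
  · rw [symm_div_sub_swap p₁ p₂ p₃ y x, symm_div_sub_swap p₁ p₂ p₃ z y,
      symm_div_sub_swap p₁ p₂ p₃ x z]
    linear_combination cyclic_sum_mul_symm_div_sub p₁ p₂ p₃ huv huw hvw -
      cyclic_sum_mul_symm_div_sub p₁ p₂ p₃ hxy hxz hyz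
  · rw [symm_div_sub_swap p₁ p₂ p₃ u v, symm_div_sub_swap p₁ p₂ p₃ x y]
    ring
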